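/- arXiv:1701.08220 — 3 statements merged into one kernel-verified Lean document; each statement's English description precedes it below -/
import Mathlib

section
/- If a generalized Latin square of order n > 1 contains at least 0.75·n² distinct symbols, then it has a transversal. -/
/-- A generalized Latin square of order `n`: each symbol appears at most once
in each row and at most once in each column. -/
def IsGLS {n : ℕ} (A : Fin n → Fin n → ℕ) : Prop :=
  (∀ i : Fin n, Function.Injective (A i)) ∧ (∀ j : Fin n, Function.Injective fun i => A i j)

/-- Multiplicity of a symbol `s`: number of cells of `A` containing `s`. -/
def mult {n : ℕ} (A : Fin n → Fin n → ℕ) (s : ℕ) : ℕ :=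
  (Finset.univ.filter fun p : Fin n × Fin n => A p.1 p.2 = s).card

/-- The number of distinct symbols of `A`. -/
def numSymbols {n : ℕ} (A : Fin n → Fin n → ℕ) : ℕ :=
  (Finset.image (fun p : Fin n × Fin n => A p.1 p.2) Finset.univ).card

/-- A transversal: `n` cells, one per row/column, with pairwise distinct symbols. -/
def HasTransversal {n : ℕ} (A : Fin n → Fin n → ℕ) : Prop :=
  ∃ σ : Equiv.Perm (Fin n), Function.Injective fun i => A i (σ i)

open Finset in
/-- Hall's theorem for a set `R` of cells in the grid `I ×ˢ J`: either `R` contains a matching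
of `I` into `J`, or it misses a subgrid `X ×ˢ Y` with `#J + 1 ≤ #X + #Y`. -/
lemma exists_matching_or_empty_rectangle {α : Type*} [DecidableEq α] (I J : Finset α)
    (R : Finset (α × α)) :
    (∃ f : α → α, Set.InjOn f I ∧ ∀ i ∈ I, f i ∈ J ∧ (i, f i) ∈ R) ∨
    ∃ X ⊆ I, ∃ Y ⊆ J, #J + 1 ≤ #X + #Y ∧ ∀ x ∈ X, ∀ y ∈ Y, (x, y) ∉ R := by
  classical
  let t : I → Finset α := fun i => J.filter fun y => ((i : α), y) ∈ R
  by_cases h : ∀ s : Finset I, #s ≤ #(s.biUnion t)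
  · left
    obtain ⟨f, hf, hft⟩ := (Finset.all_card_le_biUnion_card_iff_exists_injective t).1 h
    refine ⟨fun i => if hi : i ∈ I then f ⟨i, hi⟩ else i, ?_, ?_⟩
    · intro i hi k hk hik
      have hi' : i ∈ I := hi
      have hk' : k ∈ I := hk
      simp only [hi', hk', dif_pos] at hik
      exact congrArg Subtype.val (hf hik)
    · intro i hi
      simp only [hi, dif_pos]
      simpa [t] using hft ⟨i, hi⟩
  · right
    push Not at h
    obtain ⟨s, hs⟩ := h
    have hsub : s.biUnion t ⊆ J := by
      intro y hy
      obtain ⟨i, -, hi⟩ := mem_biUnion.1 hy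
      exact (mem_filter.1 hi).1
    refine ⟨s.map ⟨Subtype.val, Subtype.val_injective⟩, ?_, J \ s.biUnion t, sdiff_subset, ?_, ?_⟩
    · intro x hx
      obtain ⟨i, -, rfl⟩ := mem_map.1 hx
      exact i.2
    · rw [card_map, card_sdiff_of_subset hsub]
      have := card_le_card hsub
      omega
    · intro x hx y hy hR
      obtain ⟨i, hi, rfl⟩ := mem_map.1 hx
      obtain ⟨hyJ, hyt⟩ := mem_sdiff.1 hy
      exact hyt (mem_biUnion.2 ⟨i, hi, mem_filter.2 ⟨hyJ, hR⟩⟩)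

open Finset in
/-- In a proper coloring, a subgrid with more than `2 * #F` lines has a cell whose color is
not in `F`. -/
lemma exists_color_notMem {α : Type*} (A : α → α → ℕ)
    (hrow : ∀ i, Function.Injective (A i)) (hcol : ∀ j, Function.Injective fun i => A i j)
    {X Y : Finset α} (hX : X.Nonempty) (hY : Y.Nonempty) {F : Finset ℕ}
    (h : 2 * #F < #X + #Y) : ∃ x ∈ X, ∃ y ∈ Y, A x y ∉ F := by
  classical
  obtain ⟨x, hx⟩ := hX
  obtain ⟨y, hy⟩ := hY
  by_contra! hF
  have h₁ : #Y ≤ #F := card_le_card_of_injOn (A x) (fun z hz => hF x hx z hz)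
    (hrow x).injOn
  have h₂ : #X ≤ #F := card_le_card_of_injOn (fun z => A z y) (fun z hz => hF z hz y hy)
    (hcol y).injOn
  omega

open Finset in
/-- Deleting the lines and the color of a cell of an `R`-free subgrid `X ×ˢ Y` costs a rainbow
set `R` at most `2 * m + 1 - #X - #Y` cells. -/
lemma card_le_card_filter_add {α : Type*} [DecidableEq α] (A : α → α → ℕ) {I J X Y : Finset α}
    {R : Finset (α × α)} (hR : R ⊆ I ×ˢ J) (hinj : Set.InjOn (fun p : α × α => A p.1 p.2) R)
    (hX : X ⊆ I) (hY : Y ⊆ J) (hXY : ∀ x ∈ X, ∀ y ∈ Y, (x, y) ∉ R) {x y : α} (hx : x ∈ X)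
    (hy : y ∈ Y) (c : ℕ) :
    #R + #X + #Y ≤ #(R.filter fun p => p.1 ≠ x ∧ p.2 ≠ y ∧ A p.1 p.2 ≠ c) + #I + #J + 1 := by
  have hcover : R ⊆ (R.filter fun p => p.1 ≠ x ∧ p.2 ≠ y ∧ A p.1 p.2 ≠ c) ∪
      ((R.filter fun p => p.1 = x) ∪ (R.filter fun p => p.2 = y) ∪
        (R.filter fun p => A p.1 p.2 = c)) := by
    intro p hp
    simp only [mem_union, mem_filter, hp, true_and]
    tauto
  have hrowx : #(R.filter fun p => p.1 = x) ≤ #(J \ Y) := by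
    refine card_le_card_of_injOn Prod.snd ?_ ?_
    · intro p hp
      obtain ⟨hpR, rfl⟩ := mem_filter.1 hp
      exact mem_sdiff.2 ⟨(mem_product.1 (hR hpR)).2, fun h => hXY _ hx _ h hpR⟩
    · intro p hp q hq hpq
      exact Prod.ext ((mem_filter.1 hp).2.trans (mem_filter.1 hq).2.symm) hpq
  have hcoly : #(R.filter fun p => p.2 = y) ≤ #(I \ X) := by
    refine card_le_card_of_injOn Prod.fst ?_ ?_
    · intro p hp
      obtain ⟨hpR, rfl⟩ := mem_filter.1 hp
      exact mem_sdiff.2 ⟨(mem_product.1 (hR hpR)).1, fun h => hXY _ h _ hy hpR⟩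
    · intro p hp q hq hpq
      exact Prod.ext hpq ((mem_filter.1 hp).2.trans (mem_filter.1 hq).2.symm)
  have hcolor : #(R.filter fun p => A p.1 p.2 = c) ≤ 1 := by
    refine card_le_one.2 fun p hp q hq => ?_
    obtain ⟨hp, hpc⟩ := mem_filter.1 hp
    obtain ⟨hq, hqc⟩ := mem_filter.1 hq
    exact hinj hp hq (hpc.trans hqc.symm)
  rw [card_sdiff_of_subset hY] at hrowx
  rw [card_sdiff_of_subset hX] at hcoly
  have h₁ := card_le_card hcover
  have h₂ := card_union_le (R.filter fun p => p.1 ≠ x ∧ p.2 ≠ y ∧ A p.1 p.2 ≠ c)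
    ((R.filter fun p => p.1 = x) ∪ (R.filter fun p => p.2 = y) ∪
      (R.filter fun p => A p.1 p.2 = c))
  have h₃ := card_union_le ((R.filter fun p => p.1 = x) ∪ (R.filter fun p => p.2 = y))
    (R.filter fun p => A p.1 p.2 = c)
  have h₄ := card_union_le (R.filter fun p => p.1 = x) (R.filter fun p => p.2 = y)
  have h₅ := card_le_card hX
  have h₆ := card_le_card hY
  omega

open Finset in
/-- A properly colored `m × m` grid with a large rainbow set `R` of cells avoiding the set `F` of
colors has a rainbow perfect matching avoiding `F`. -/
lemma exists_rainbow_matching {α : Type*} [DecidableEq α] (A : α → α → ℕ)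
    (hrow : ∀ i, Function.Injective (A i)) (hcol : ∀ j, Function.Injective fun i => A i j)
    (m : ℕ) : ∀ (I J : Finset α) (F : Finset ℕ) (R : Finset (α × α)), #I = m → #J = m →
      R ⊆ I ×ˢ J → Set.InjOn (fun p : α × α => A p.1 p.2) R → (∀ p ∈ R, A p.1 p.2 ∉ F) →
      3 * m ^ 2 + 2 * m * #F + #F ^ 2 ≤ 2 * #F + 4 * #R →
      ∃ f : α → α, Set.InjOn f I ∧ Set.InjOn (fun i => A i (f i)) I ∧
        ∀ i ∈ I, f i ∈ J ∧ A i (f i) ∉ F := by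
  induction m with
  | zero =>
    intro I J F R hI _ _ _ _ _
    obtain rfl := card_eq_zero.1 hI
    exact ⟨id, by simp, by simp, by simp⟩
  | succ k ih =>
    intro I J F R hI hJ hR hinj hF hcard
    obtain ⟨f, hf, hfR⟩ | ⟨X, hX, Y, hY, hab, hXY⟩ := exists_matching_or_empty_rectangle I J R
    · refine ⟨f, hf, fun i hi i' hi' h => ?_, fun i hi => ⟨(hfR i hi).1, hF _ (hfR i hi).2⟩⟩
      exact congrArg Prod.fst (hinj (hfR i hi).2 (hfR i' hi').2 h)
    have hXc := card_le_card hX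
    have hYc := card_le_card hY
    have hmiss : #R + #X * #Y ≤ (k + 1) ^ 2 := by
      have hdisj : Disjoint R (X ×ˢ Y) := by
        refine disjoint_left.2 fun p hp hq => ?_
        exact hXY _ (mem_product.1 hq).1 _ (mem_product.1 hq).2 hp
      have h := card_le_card (union_subset hR (product_subset_product hX hY))
      rwa [card_union_of_disjoint hdisj, card_product, card_product, hI, hJ, ← sq] at h
    have hX0 : 1 ≤ #X := by omega
    have hY0 : 1 ≤ #Y := by omega
    have hbig : k + 1 ≤ #X * #Y := by nlinarith
    have hlt : 2 * #F < #X + #Y := by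
      by_contra! h
      have h₁ : k + 2 ≤ 2 * #F := by omega
      zify at *
      nlinarith [sq_nonneg ((#F : ℤ) - 1)]
    obtain ⟨x, hx, y, hy, hc⟩ := exists_color_notMem A hrow hcol (card_pos.1 hX0)
      (card_pos.1 hY0) hlt
    have hRc := card_le_card_filter_add A hR hinj hX hY hXY hx hy (A x y)
    have hRsub := filter_subset (fun p : α × α => p.1 ≠ x ∧ p.2 ≠ y ∧ A p.1 p.2 ≠ A x y) R
    obtain ⟨f, hf, hfA, hfJ⟩ := ih (I.erase x) (J.erase y) (insert (A x y) F)
      (R.filter fun p => p.1 ≠ x ∧ p.2 ≠ y ∧ A p.1 p.2 ≠ A x y)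
      (by rw [card_erase_of_mem (hX hx), hI, Nat.add_sub_cancel])
      (by rw [card_erase_of_mem (hY hy), hJ, Nat.add_sub_cancel])
      (fun p hp => by
        obtain ⟨hp, hpx, hpy, -⟩ := mem_filter.1 hp
        have := mem_product.1 (hR hp)
        exact mem_product.2 ⟨mem_erase.2 ⟨hpx, this.1⟩, mem_erase.2 ⟨hpy, this.2⟩⟩)
      (hinj.mono hRsub)
      (fun p hp h => by
        obtain ⟨hp, -, -, hpc⟩ := mem_filter.1 hp
        exact (mem_insert.1 h).elim hpc (hF p hp))
      (by rw [card_insert_of_notMem hc]; nlinarith)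
    have hne : ∀ i ∈ I, i ≠ x → f i ∈ J ∧ f i ≠ y ∧ A i (f i) ≠ A x y ∧ A i (f i) ∉ F := by
      intro i hi hix
      obtain ⟨h₁, h₂⟩ := hfJ i (mem_erase.2 ⟨hix, hi⟩)
      rw [mem_erase] at h₁
      rw [mem_insert, not_or] at h₂
      exact ⟨h₁.2, h₁.1, h₂.1, h₂.2⟩
    have hmem : ∀ i ∈ I, i ≠ x → i ∈ (↑(I.erase x) : Set α) := fun i hi hix =>
      mem_coe.2 (mem_erase.2 ⟨hix, hi⟩)
    refine ⟨Function.update f x y, ?_, ?_, ?_⟩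
    · intro i hi i' hi' h
      by_cases hix : i = x <;> by_cases hix' : i' = x
      · rw [hix, hix']
      · subst hix
        simp only [Function.update_self, Function.update_of_ne hix'] at h
        exact absurd h.symm (hne i' hi' hix').2.1
      · subst hix'
        simp only [Function.update_self, Function.update_of_ne hix] at h
        exact absurd h (hne i hi hix).2.1
      · simp only [Function.update_of_ne hix, Function.update_of_ne hix'] at h
        exact hf (hmem i hi hix) (hmem i' hi' hix') h
    · intro i hi i' hi' h
      by_cases hix : i = x <;> by_cases hix' : i' = x
      · rw [hix, hix']
      · subst hix
        simp only [Function.update_self, Function.update_of_ne hix'] at h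
        exact absurd h.symm (hne i' hi' hix').2.2.1
      · subst hix'
        simp only [Function.update_self, Function.update_of_ne hix] at h
        exact absurd h (hne i hi hix).2.2.1
      · simp only [Function.update_of_ne hix, Function.update_of_ne hix'] at h
        exact hfA (hmem i hi hix) (hmem i' hi' hix') h
    · intro i hi
      by_cases hix : i = x
      · subst hix
        rw [Function.update_self]
        exact ⟨hY hy, hc⟩
      · rw [Function.update_of_ne hix]
        exact ⟨(hne i hi hix).1, (hne i hi hix).2.2.2⟩

theorem stmt_7 (n : ℕ) (hn : 1 < n) (A : Fin n → Fin n → ℕ) (hA : IsGLS A)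
    (hsym : (0.75 : ℝ) * (n : ℝ) ^ 2 ≤ (numSymbols A : ℝ)) :
    HasTransversal A := by
  obtain ⟨R, -, hinj, himg⟩ := Finset.exists_subset_injOn_image_eq_of_surjOn
    (f := fun p : Fin n × Fin n => A p.1 p.2) Set.univ
    (Finset.image (fun p : Fin n × Fin n => A p.1 p.2) Finset.univ)
    (by intro c hc; simpa using hc)
  have hR : R.card = numSymbols A := by
    rw [numSymbols, ← himg, Finset.card_image_of_injOn hinj]
  have hcard : 3 * n ^ 2 ≤ 4 * R.card := by
    rw [hR]
    have : (3 : ℝ) * (n : ℝ) ^ 2 ≤ 4 * (numSymbols A : ℝ) := by linarith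
    exact_mod_cast this
  obtain ⟨f, hf, hfA, -⟩ := exists_rainbow_matching A hA.1 hA.2 n Finset.univ Finset.univ ∅ R
    (by simp) (by simp) (by simp) hinj (by simp) (by simpa using hcard)
  rw [Finset.coe_univ, Set.injOn_univ] at hf hfA
  exact ⟨Equiv.ofBijective f (Finite.injective_iff_bijective.1 hf), hfA⟩
end

section
/- Every proper edge-coloring of the complete graph K_{2n}, n > 2, with exactly 2n−1 colors contains a multicolored perfect matching (a 1-factor whose n edges have pairwise distinct colors). -/
open Finset Function

namespace RainbowMatching

variable {V K : Type*}

/-- A symmetric colouring of the pairs of vertices in which edges sharing a vertex get different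
colours. -/
structure IsProper (c : V → V → K) : Prop where
  symm : ∀ i j, c i j = c j i
  proper : ∀ i j k, i ≠ j → i ≠ k → j ≠ k → c i j ≠ c i k

/-- An involution `f`, viewed as the matching with edges `{i, f i}` for `f i ≠ i`, whose edges
have pairwise distinct colours. -/
structure IsRainbow (c : V → V → K) (f : V → V) : Prop where
  invol : ∀ i, f (f i) = i
  rainbow : ∀ i j, f i ≠ i → f j ≠ j → c i (f i) = c j (f j) → i = j ∨ i = f j

/-- The colour `k` does not occur on the matching `f`. -/
def Unused (c : V → V → K) (f : V → V) (k : K) : Prop :=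
  ∀ i, f i ≠ i → c i (f i) ≠ k

section Exchange

variable [DecidableEq V] {c : V → V → K} {f : V → V}

/-- Remove the edge at `x` from the matching `f`. -/
def removeEdge (f : V → V) (x : V) : V → V :=
  fun y => if y = x ∨ y = f x then y else f y

/-- Add the edge `{u, v}` to the matching `f`. -/
def addEdge (f : V → V) (u v : V) : V → V :=
  fun y => if y = u then v else if y = v then u else f y

lemma IsRainbow.removeEdge (hf : IsRainbow c f) (x : V) : IsRainbow c (removeEdge f x) := by
  have h1 := hf.invol
  have h2 := hf.rainbow
  constructor
  · intro i
    unfold RainbowMatching.removeEdge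
    grind
  · intro i j
    unfold RainbowMatching.removeEdge
    grind

lemma IsRainbow.unused_removeEdge (hc : IsProper c) (hf : IsRainbow c f) {x : V} (hx : f x ≠ x)
    (k : K) : Unused c (RainbowMatching.removeEdge f x) k ↔ Unused c f k ∨ k = c x (f x) := by
  have h1 := hf.invol
  have h2 := hf.rainbow
  have h3 := hc.symm
  unfold Unused RainbowMatching.removeEdge
  constructor
  · intro h
    by_contra! hk
    obtain ⟨⟨i, hi, hik⟩, hk⟩ := hk
    have := h i
    grind
  · rintro h i hi
    grind

lemma IsRainbow.addEdge (hc : IsProper c) (hf : IsRainbow c f) {u v : V} (huv : u ≠ v)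
    (hu : f u = u) (hv : f v = v) (hk : Unused c f (c u v)) :
    IsRainbow c (addEdge f u v) := by
  have h1 := hf.invol
  have h2 := hf.rainbow
  have h3 := hc.symm
  unfold Unused at hk
  constructor
  · intro i
    unfold RainbowMatching.addEdge
    grind
  · intro i j
    unfold RainbowMatching.addEdge
    grind

lemma unused_addEdge (hc : IsProper c) {u v : V} (huv : u ≠ v)
    (hu : f u = u) (hv : f v = v) (k : K) :
    Unused c (addEdge f u v) k ↔ Unused c f k ∧ k ≠ c u v := by
  have h3 := hc.symm
  unfold Unused addEdge
  constructor
  · intro h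
    refine ⟨fun i hi => ?_, ?_⟩
    · have := h i
      grind
    · have := h u
      grind
  · rintro ⟨h, hk⟩ i hi
    grind

end Exchange

variable [Fintype V] [DecidableEq V]

/-- The vertices not covered by the matching `f`. -/
def uncovered (f : V → V) : Finset V := {i | f i = i}

lemma mem_uncovered {f : V → V} {i : V} : i ∈ uncovered f ↔ f i = i := by simp [uncovered]

/-- A rainbow matching leaving as few vertices uncovered as possible. -/
structure IsMaximum (c : V → V → K) (f : V → V) : Prop extends IsRainbow c f where
  card_le : ∀ g, IsRainbow c g → #(uncovered f) ≤ #(uncovered g)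

variable {c : V → V → K} {f : V → V}

lemma exists_isMaximum (c : V → V → K) : ∃ f, IsMaximum c f := by
  have hne : ∃ m, ∃ f, IsRainbow c f ∧ #(uncovered f) = m :=
    ⟨_, id, ⟨fun _ => rfl, fun i _ h => absurd rfl h⟩, rfl⟩
  classical
  obtain ⟨f, hf, hm⟩ := Nat.find_spec hne
  exact ⟨f, hf, fun g hg => hm ▸ Nat.find_min' hne ⟨g, hg, rfl⟩⟩

lemma card_uncovered_addEdge {u v : V} (huv : u ≠ v) (hu : f u = u) (hv : f v = v) :
    #(uncovered (addEdge f u v)) + 2 = #(uncovered f) := by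
  have h : uncovered f = insert u (insert v (uncovered (addEdge f u v))) := by
    ext i
    simp only [mem_insert, mem_uncovered, addEdge]
    grind
  rw [h, card_insert_of_notMem, card_insert_of_notMem]
  · simp only [mem_uncovered, addEdge]
    grind
  · simp only [mem_insert, mem_uncovered, addEdge]
    grind

lemma card_uncovered_removeEdge (hf : IsRainbow c f) {x : V} (hx : f x ≠ x) :
    #(uncovered (removeEdge f x)) = #(uncovered f) + 2 := by
  have h1 := hf.invol
  have h : uncovered (removeEdge f x) = insert x (insert (f x) (uncovered f)) := by
    ext i
    simp only [mem_insert, mem_uncovered, removeEdge]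
    grind
  rw [h, card_insert_of_notMem, card_insert_of_notMem]
  · simp only [mem_uncovered]
    grind
  · simp only [mem_insert, mem_uncovered]
    grind

/-- An edge between uncovered vertices cannot have an unused colour. -/
lemma IsMaximum.not_unused (hc : IsProper c) (hf : IsMaximum c f) {u v : V} (huv : u ≠ v)
    (hu : f u = u) (hv : f v = v) : ¬ Unused c f (c u v) := by
  intro hk
  have h1 := hf.card_le _ (hf.toIsRainbow.addEdge hc huv hu hv hk)
  have h2 := card_uncovered_addEdge huv hu hv
  omega

/-- Replacing the matching edge at `x` by the edge `{u, x}` of an unused colour. -/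
lemma IsRainbow.slide (hc : IsProper c) (hf : IsRainbow c f) {u x : V}
    (hu : f u = u) (hx : f x ≠ x) (hux : Unused c f (c u x)) :
    IsRainbow c (RainbowMatching.addEdge (RainbowMatching.removeEdge f x) u x) ∧
    #(uncovered (RainbowMatching.addEdge (RainbowMatching.removeEdge f x) u x)) =
      #(uncovered f) ∧
    ∀ k, Unused c (RainbowMatching.addEdge (RainbowMatching.removeEdge f x) u x) k ↔
      (Unused c f k ∨ k = c x (f x)) ∧ k ≠ c u x := by
  have hne : u ≠ x := by rintro rfl; exact hx hu
  have hu' : RainbowMatching.removeEdge f x u = u := by simp [RainbowMatching.removeEdge, hu]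
  have hx' : RainbowMatching.removeEdge f x x = x := by simp [RainbowMatching.removeEdge]
  refine ⟨(hf.removeEdge x).addEdge hc hne hu' hx' ?_, ?_, fun k => ?_⟩
  · exact (hf.unused_removeEdge hc hx _).2 (.inl hux)
  · have h1 := card_uncovered_addEdge hne hu' hx'
    have h2 := card_uncovered_removeEdge hf hx
    omega
  · rw [unused_addEdge hc hne hu' hx', hf.unused_removeEdge hc hx]

/-- Two edges of unused colours joining uncovered vertices to the two ends of a matching edge have
the same colour. -/
lemma IsMaximum.color_eq (hc : IsProper c) (hf : IsMaximum c f) {u v x : V} (huv : u ≠ v)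
    (hu : f u = u) (hv : f v = v) (hx : f x ≠ x) (hux : Unused c f (c u x))
    (hvx : Unused c f (c v (f x))) : c u x = c v (f x) := by
  by_contra hne
  obtain ⟨h1, h2, h3⟩ := hf.toIsRainbow.slide hc hu hx hux
  have h4 : IsMaximum c (addEdge (removeEdge f x) u x) := ⟨h1, fun g hg => h2 ▸ hf.card_le g hg⟩
  have h5 := hf.invol
  refine h4.not_unused hc (u := v) (v := f x) ?_ ?_ ?_ ((h3 _).2 ⟨.inl hvx, Ne.symm hne⟩)
  · grind
  · simp only [addEdge, removeEdge]
    grind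
  · simp only [addEdge, removeEdge]
    grind

section Counting

variable [Fintype K]

open Classical in
lemma image_color_eq_univ (hc : IsProper c) (hcard : Fintype.card V = Fintype.card K + 1) (u : V) :
    (univ.erase u).image (c u) = univ := by
  apply eq_univ_of_card
  rw [card_image_of_injOn, card_erase_of_mem (mem_univ u), card_univ, hcard, Nat.add_sub_cancel]
  intro i hi j hj hij
  by_contra hne
  simp only [coe_erase, coe_univ, Set.mem_sdiff, Set.mem_univ, Set.mem_singleton_iff,
    true_and] at hi hj
  exact hc.proper u i j (Ne.symm hi) (Ne.symm hj) hne hij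

open Classical in
/-- The set of unused colours. -/
noncomputable def unusedColors (c : V → V → K) (f : V → V) : Finset K := {k | Unused c f k}

open Classical in
/-- The vertices joined to `u` by an edge of unused colour. -/
noncomputable def unusedNeighbors (c : V → V → K) (f : V → V) (u : V) : Finset V :=
  {x | x ≠ u ∧ Unused c f (c u x)}

omit [Fintype K] in
lemma mem_unusedNeighbors {u x : V} :
    x ∈ unusedNeighbors c f u ↔ x ≠ u ∧ Unused c f (c u x) := by
  simp [unusedNeighbors]

lemma card_unusedNeighbors (hc : IsProper c) (hcard : Fintype.card V = Fintype.card K + 1)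
    (u : V) : #(unusedNeighbors c f u) = #(unusedColors c f) := by
  classical
  apply card_bij (fun x _ => c u x)
  · intro x hx
    simpa [unusedColors] using (mem_unusedNeighbors.1 hx).2
  · intro x hx y hy hxy
    by_contra hne
    exact hc.proper u x y (mem_unusedNeighbors.1 hx).1.symm (mem_unusedNeighbors.1 hy).1.symm
      hne hxy
  · intro k hk
    have : k ∈ (univ.erase u).image (c u) := by simp [image_color_eq_univ hc hcard u]
    obtain ⟨x, hx, rfl⟩ := mem_image.1 this
    exact ⟨x, mem_unusedNeighbors.2 ⟨by simpa using hx, by simpa [unusedColors] using hk⟩, rfl⟩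

lemma card_unusedColors (hc : IsProper c) (hf : IsRainbow c f) :
    2 * #(unusedColors c f) + Fintype.card V = 2 * Fintype.card K + #(uncovered f) := by
  classical
  have h1 := hf.invol
  have hfib : #(uncovered f)ᶜ = #(unusedColors c f)ᶜ * 2 := by
    rw [card_eq_sum_card_fiberwise (f := fun i => c i (f i)) (t := (unusedColors c f)ᶜ),
      sum_const_nat]
    · intro k hk
      rw [mem_compl, unusedColors, mem_filter_univ] at hk
      simp only [Unused, not_forall, not_not] at hk
      obtain ⟨i, hi, rfl⟩ := hk
      rw [← card_pair (Ne.symm hi)]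
      congr 1
      ext j
      have h2 := hf.rainbow j i
      have h3 := hc.symm
      simp only [mem_filter, mem_compl, mem_uncovered, mem_insert, mem_singleton]
      grind
    · intro i hi
      simp only [coe_compl, Set.mem_compl_iff, mem_coe, mem_uncovered] at hi
      rw [mem_coe, mem_compl, unusedColors, mem_filter_univ]
      exact fun h => h i hi rfl
  rw [card_compl, card_compl] at hfib
  have := card_le_univ (uncovered f)
  have := card_le_univ (unusedColors c f)
  omega

omit [Fintype K] in
lemma IsMaximum.unusedNeighbors_subset (hc : IsProper c) (hf : IsMaximum c f) {u : V}
    (hu : f u = u) : unusedNeighbors c f u ⊆ (uncovered f)ᶜ := by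
  intro x hx
  rw [mem_unusedNeighbors] at hx
  rw [mem_compl, mem_uncovered]
  exact fun h => hf.not_unused hc hx.1.symm hu h hx.2

open Classical in
/-- The vertices `z` such that the edges `{v, z}` and `{u, f z}` have the same unused colour. -/
noncomputable def exchangeVertices (c : V → V → K) (f : V → V) (u v : V) : Finset V :=
  {z | f z ≠ z ∧ Unused c f (c v z) ∧ c v z = c u (f z)}

omit [Fintype K] in
lemma mem_exchangeVertices {u v z : V} : z ∈ exchangeVertices c f u v ↔
    f z ≠ z ∧ Unused c f (c v z) ∧ c v z = c u (f z) := by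
  simp [exchangeVertices]

lemma IsMaximum.two_le_card_exchangeVertices (hc : IsProper c)
    (hcard : Fintype.card V = Fintype.card K + 1) (hf : IsMaximum c f)
    (h2 : #(uncovered f) = 2) {u v : V} (huv : u ≠ v) (hu : f u = u) (hv : f v = v) :
    2 ≤ #(exchangeVertices c f u v) := by
  have hinv := hf.invol
  have hA := hf.unusedNeighbors_subset hc hu
  have hB := hf.unusedNeighbors_subset hc hv
  have hsub : (unusedNeighbors c f u).image f ∪ unusedNeighbors c f v ⊆ (uncovered f)ᶜ := by
    refine union_subset (image_subset_iff.2 fun x hx => ?_) hB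
    have := hA hx
    simp only [mem_compl, mem_uncovered] at this ⊢
    grind
  have hinter : (unusedNeighbors c f u).image f ∩ unusedNeighbors c f v ⊆
      exchangeVertices c f u v := by
    intro z hz
    obtain ⟨hz1, hz2⟩ := mem_inter.1 hz
    obtain ⟨x, hx, rfl⟩ := mem_image.1 hz1
    have hxc := hA hx
    rw [mem_compl, mem_uncovered] at hxc
    rw [mem_unusedNeighbors] at hx hz2
    refine mem_exchangeVertices.2 ⟨by grind, hz2.2, ?_⟩
    rw [hinv]
    exact (hf.color_eq hc huv hu hv hxc hx.2 hz2.2).symm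
  have e1 := card_le_card hsub
  have e2 := card_le_card hinter
  have e3 := card_union_add_card_inter ((unusedNeighbors c f u).image f) (unusedNeighbors c f v)
  rw [card_image_of_injective _ (Involutive.injective hinv), card_unusedNeighbors hc hcard,
    card_unusedNeighbors hc hcard] at e3
  rw [card_compl] at e1
  have e4 := card_unusedColors hc hf.toIsRainbow
  omega

omit [Fintype K] in
/-- Among the uncovered vertices, at most as many pairs as there are uncovered vertices send an
edge of unused colour to a given matching edge. -/
lemma IsMaximum.card_filter_add_card_filter_le (hc : IsProper c) (hf : IsMaximum c f)
    (h4 : 4 ≤ #(uncovered f)) {x : V} (hx : f x ≠ x) :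
    #{w ∈ uncovered f | x ∈ unusedNeighbors c f w} +
      #{w ∈ uncovered f | f x ∈ unusedNeighbors c f w} ≤ #(uncovered f) := by
  have hinv := hf.invol
  have key : ∀ y, f y ≠ y → (∃ w ∈ uncovered f, f y ∈ unusedNeighbors c f w) →
      #{w ∈ uncovered f | y ∈ unusedNeighbors c f w} ≤ 2 := by
    rintro y hy ⟨w, hw, hyw⟩
    rw [mem_uncovered] at hw
    have hsub : #({w' ∈ uncovered f | y ∈ unusedNeighbors c f w'}.erase w) ≤ 1 := by
      rw [card_le_one]
      intro a ha b hb
      simp only [mem_erase, mem_filter, mem_uncovered, mem_unusedNeighbors] at ha hb hyw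
      have ea := hf.color_eq hc ha.1 ha.2.1 hw hy ha.2.2.2 hyw.2
      have eb := hf.color_eq hc hb.1 hb.2.1 hw hy hb.2.2.2 hyw.2
      by_contra hab
      refine hc.proper y a b ha.2.2.1 hb.2.2.1 hab ?_
      rw [hc.symm y a, hc.symm y b, ea, eb]
    have := pred_card_le_card_erase (s := {w' ∈ uncovered f | y ∈ unusedNeighbors c f w'})
      (a := w)
    omega
  by_cases h1 : ∃ w ∈ uncovered f, f x ∈ unusedNeighbors c f w
  · by_cases h2 : ∃ w ∈ uncovered f, x ∈ unusedNeighbors c f w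
    · have e1 := key x hx h1
      have e2 := key (f x) (by grind) (by rwa [hinv])
      omega
    · rw [filter_false_of_mem (s := uncovered f) (p := fun w => x ∈ unusedNeighbors c f w)
        (by simpa using h2), card_empty, zero_add]
      exact card_filter_le _ _
  · rw [filter_false_of_mem (s := uncovered f) (p := fun w => f x ∈ unusedNeighbors c f w)
      (by simpa using h1), card_empty, add_zero]
    exact card_filter_le _ _

lemma IsMaximum.card_uncovered_lt (hc : IsProper c)
    (hcard : Fintype.card V = Fintype.card K + 1) (hf : IsMaximum c f) :
    #(uncovered f) < 4 := by
  by_contra! h4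
  have hinv := hf.invol
  have hsum : ∑ x ∈ (uncovered f)ᶜ, #{w ∈ uncovered f | x ∈ unusedNeighbors c f w} =
      #(uncovered f) * #(unusedColors c f) := by
    refine (sum_card_bipartiteAbove_eq_sum_card_bipartiteBelow (s := (uncovered f)ᶜ)
      (t := uncovered f) (fun x w => x ∈ unusedNeighbors c f w)).trans ?_
    rw [sum_const_nat fun w hw => ?_]
    rw [← card_unusedNeighbors hc hcard w, bipartiteBelow, filter_mem_eq_inter,
      inter_eq_right.2 (hf.unusedNeighbors_subset hc (mem_uncovered.1 hw))]
  have hsum' : ∑ x ∈ (uncovered f)ᶜ, #{w ∈ uncovered f | f x ∈ unusedNeighbors c f w} =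
      #(uncovered f) * #(unusedColors c f) := by
    rw [← hsum]
    refine sum_nbij' f f ?_ ?_ ?_ ?_ ?_ <;> simp only [mem_compl, mem_uncovered] <;> grind
  have hle : ∑ x ∈ (uncovered f)ᶜ, (#{w ∈ uncovered f | x ∈ unusedNeighbors c f w} +
      #{w ∈ uncovered f | f x ∈ unusedNeighbors c f w}) ≤ #(uncovered f)ᶜ * #(uncovered f) := by
    rw [← smul_eq_mul]
    refine sum_le_card_nsmul _ _ _ fun x hx => ?_
    rw [mem_compl, mem_uncovered] at hx
    exact hf.card_filter_add_card_filter_le hc h4 hx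
  rw [sum_add_distrib, hsum, hsum', card_compl] at hle
  have e4 := card_unusedColors hc hf.toIsRainbow
  have e5 : 2 * #(unusedColors c f) ≤ Fintype.card V - #(uncovered f) := by
    refine Nat.le_of_mul_le_mul_left (c := #(uncovered f)) ?_ (by omega)
    linarith
  have := card_le_univ (uncovered f)
  omega

omit [Fintype K] in
/-- The vertices `z` that occur in the exchange set obtained by sliding along `{u, x}`, in terms
of the original matching. -/
lemma IsMaximum.mem_exchangeVertices_slide (hc : IsProper c) (hf : IsMaximum c f) {u v x z : V}
    (huv : u ≠ v) (hu : f u = u) (hv : f v = v) (hx : f x ≠ x) (hux : Unused c f (c u x))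
    (hz : z ∈ exchangeVertices c (addEdge (removeEdge f x) u x) (f x) v) :
    (z = u ∧ c v u = c x (f x)) ∨
    (z ∈ unusedNeighbors c f v ∧ z ≠ u ∧
      ((z = x ∧ c v z = c (f x) u) ∨ c v z = c (f x) (f z) ∧ f z ≠ f x)) := by
  have hinv := hf.invol
  have hsymm := hc.symm
  have hprop := hc.proper
  rw [mem_exchangeVertices, (hf.toIsRainbow.slide hc hu hx hux).2.2] at hz
  obtain ⟨h1, ⟨h2, h3⟩, h4⟩ := hz
  have hnot := hf.not_unused hc huv hu hv
  rw [mem_unusedNeighbors]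
  have hux' : u ≠ x := by rintro rfl; exact hx hu
  have hvx : v ≠ x := by rintro rfl; exact hx hv
  simp only [addEdge, removeEdge] at h1 h4
  by_cases hzu : z = u
  · grind
  · by_cases hzx : z = x
    · have := hprop x v (f x)
      grind
    · have hzx' : f z ≠ f x := fun h => hzx (by rw [← hinv z, h, hinv])
      have hxz : f z ≠ x := fun h => hzx' (by grind)
      have := hprop (f x) x (f z)
      grind

lemma IsMaximum.card_uncovered_ne_two (hc : IsProper c)
    (hcard : Fintype.card V = Fintype.card K + 1) (hV : 4 < Fintype.card V)
    (hf : IsMaximum c f) : #(uncovered f) ≠ 2 := by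
  intro h2
  classical
  have hinv := hf.invol
  obtain ⟨u, v, huv, huncov⟩ := card_eq_two.1 h2
  have hu : f u = u := mem_uncovered.1 (by simp [huncov])
  have hv : f v = v := mem_uncovered.1 (by simp [huncov])
  set r : V → V → Prop := fun x z =>
    z ∈ exchangeVertices c (addEdge (removeEdge f x) u x) (f x) v with hr
  have hcover : ∀ x ∈ unusedNeighbors c f u, f x ≠ x := fun x hx => by
    simpa [mem_uncovered] using hf.unusedNeighbors_subset hc hu hx
  have hmem : ∀ x ∈ unusedNeighbors c f u, ∀ z, r x z → _ := fun x hx z hz =>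
    hf.mem_exchangeVertices_slide hc huv hu hv (hcover x hx) (mem_unusedNeighbors.1 hx).2 hz
  have hlower : #(unusedNeighbors c f u) * 2 ≤
      ∑ x ∈ unusedNeighbors c f u, #(bipartiteAbove r univ x) := by
    rw [← smul_eq_mul]
    refine card_nsmul_le_sum _ _ _ fun x hx => ?_
    have hxf := hcover x hx
    obtain ⟨g1, g2, -⟩ := hf.toIsRainbow.slide hc hu hxf (mem_unusedNeighbors.1 hx).2
    have g3 : IsMaximum c (addEdge (removeEdge f x) u x) :=
      ⟨g1, fun g hg => g2 ▸ hf.card_le g hg⟩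
    refine (g3.two_le_card_exchangeVertices hc hcard (g2.trans h2) (u := f x) (v := v)
      ?_ ?_ ?_).trans_eq ?_
    · grind
    · simp only [addEdge, removeEdge]
      grind
    · simp only [addEdge, removeEdge]
      grind
    · simp [bipartiteAbove, hr]
  have hu_le : #(bipartiteBelow r (unusedNeighbors c f u) u) ≤ 2 := by
    obtain ⟨p, hp, hpc⟩ : ∃ p, f p ≠ p ∧ c p (f p) = c v u := by
      simpa [Unused] using hf.not_unused hc huv.symm hv hu
    refine (card_le_card (t := {p, f p}) fun x hx => ?_).trans card_le_two
    rw [mem_bipartiteBelow] at hx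
    have h1 := hmem x hx.1 u hx.2
    have h3 := hf.rainbow x p (hcover x hx.1) hp
    rw [mem_insert, mem_singleton]
    grind
  have hother : ∑ z ∈ univ.erase u, #(bipartiteBelow r (unusedNeighbors c f u) z) ≤
      #(unusedNeighbors c f v) := by
    have : ∀ z ∈ univ.erase u, #(bipartiteBelow r (unusedNeighbors c f u) z) ≤
        if z ∈ unusedNeighbors c f v then 1 else 0 := by
      intro z hz
      rw [mem_erase] at hz
      split_ifs with hzv
      · rw [card_le_one]
        intro x hx y hy
        rw [mem_bipartiteBelow] at hx hy
        have hx1 := hmem x hx.1 z hx.2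
        have hy1 := hmem y hy.1 z hy.2
        have h1 := hcover x hx.1
        have h2 := hcover y hy.1
        have hne : ∀ w, w ≠ u → f w ≠ u := fun w hw h => hw (by rw [← hinv w, h, hu])
        have hxu := hne x (mem_unusedNeighbors.1 hx.1).1
        have hyu := hne y (mem_unusedNeighbors.1 hy.1).1
        have hzu := hne z hz.1
        by_contra hxy
        have hfxy : f x ≠ f y := fun h => hxy (by rw [← hinv x, h, hinv])
        have h3 := hc.symm
        have h4 := hc.proper (f z) (f x) (f y)
        have h6 := hc.proper (f z) u (f x)
        have h7 := hc.proper (f z) u (f y)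
        grind
      · rw [Nat.le_zero, card_eq_zero, eq_empty_iff_forall_notMem]
        intro x hx
        rw [mem_bipartiteBelow] at hx
        have := hmem x hx.1 z hx.2
        grind
    refine (sum_le_sum this).trans ?_
    rw [← card_filter]
    exact card_le_card fun x hx => (mem_filter.1 hx).2
  have e := sum_card_bipartiteAbove_eq_sum_card_bipartiteBelow (s := unusedNeighbors c f u)
    (t := univ) r
  rw [← add_sum_erase univ _ (mem_univ u)] at e
  rw [card_unusedNeighbors hc hcard] at hlower hother
  have e4 := card_unusedColors hc hf.toIsRainbow
  omega

/-- A proper colouring of a complete graph of even order exceeding four with as few colours as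
possible has a rainbow perfect matching. -/
theorem exists_isRainbow_forall_ne (hc : IsProper c)
    (hcard : Fintype.card V = Fintype.card K + 1) (heven : Even (Fintype.card V))
    (hV : 4 < Fintype.card V) : ∃ f, IsRainbow c f ∧ ∀ i, f i ≠ i := by
  obtain ⟨f, hf⟩ := exists_isMaximum c
  refine ⟨f, hf.toIsRainbow, fun i hi => ?_⟩
  have h1 := hf.card_uncovered_lt hc hcard
  have h2 := hf.card_uncovered_ne_two hc hcard hV
  have h3 := card_unusedColors hc hf.toIsRainbow
  have h4 : 0 < #(uncovered f) := card_pos.2 ⟨i, mem_uncovered.2 hi⟩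
  obtain ⟨m, hm⟩ := heven
  omega

end Counting

end RainbowMatching

/-- Woolbright–Fu: every proper edge-coloring of `K_{2n}` (`n > 2`) with the
minimum number `2n-1` of colors contains a multicolored perfect matching. -/
theorem stmt_11 (n : ℕ) (hn : 2 < n)
    (c : Fin (2 * n) → Fin (2 * n) → Fin (2 * n - 1))
    (hsymm : ∀ i j : Fin (2 * n), c i j = c j i)
    (hproper : ∀ i j k : Fin (2 * n), i ≠ j → i ≠ k → j ≠ k → c i j ≠ c i k) :
    ∃ M : Equiv.Perm (Fin (2 * n)),
      (∀ i : Fin (2 * n), M i ≠ i) ∧ (∀ i : Fin (2 * n), M (M i) = i) ∧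
      (∀ i j : Fin (2 * n), c i (M i) = c j (M j) → i = j ∨ i = M j) := by
  obtain ⟨f, hf, hne⟩ := RainbowMatching.exists_isRainbow_forall_ne (c := c) ⟨hsymm, hproper⟩
    (by simp only [Fintype.card_fin]; omega) (by simp) (by simp only [Fintype.card_fin]; omega)
  exact ⟨Function.Involutive.toPerm f hf.invol, hne, hf.invol,
    fun i j h => hf.rainbow i j (hne i) (hne j) h⟩
end

section
/- Every generalized Latin square of order 4 with at least 6 distinct symbols has a transversal. -/
/-- The permutations of four points fixing at least two elements of a nonempty set `R` are few
compared with the size of `R`. -/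
lemma card_perm_fixing_two_le (R : Finset (Fin 4)) (hR : R.Nonempty) :
    3 * (Finset.univ.filter fun σ : Equiv.Perm (Fin 4) =>
      ∃ i ∈ R, ∃ j ∈ R, i ≠ j ∧ σ i = i ∧ σ j = j).card + 7 ≤ 7 * R.card := by
  revert R
  decide +kernel

/-- In a generalized Latin square, the cells containing a given symbol lie on the graph of a
permutation. -/
lemma IsGLS.exists_perm {n : ℕ} {A : Fin n → Fin n → ℕ} (hA : IsGLS A) (s : ℕ) :
    ∃ τ : Equiv.Perm (Fin n), ∀ i j, A i j = s → τ i = j := by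
  classical
  let col : Fin n → Fin n := fun i => if h : ∃ j, A i j = s then h.choose else i
  have hcol : ∀ i, (∃ j, A i j = s) → A i (col i) = s := by
    intro i h
    simp only [col, dif_pos h]
    exact h.choose_spec
  have hinj : Set.InjOn col {i | ∃ j, A i j = s} := by
    intro i hi i' hi' h
    refine hA.2 (col i) ?_
    change A i (col i) = A i' (col i)
    rw [hcol i hi, h, hcol i' hi']
  obtain ⟨g, hg⟩ := Set.MapsTo.exists_equiv_extend_of_card_eq (t := Finset.univ) (by simp)
    (fun _ _ => Finset.mem_coe.2 (Finset.mem_univ _)) hinj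
  refine ⟨g.trans (Equiv.subtypeUnivEquiv Finset.mem_univ), fun i j hij => ?_⟩
  exact (hg i ⟨j, hij⟩).trans (hA.1 i ((hcol i ⟨j, hij⟩).trans hij.symm))

/-- The permutations meeting the cells of the symbol `s` at least twice are few compared with the
multiplicity of `s`. -/
lemma IsGLS.card_perm_repeating_le {A : Fin 4 → Fin 4 → ℕ} (hA : IsGLS A) {s : ℕ}
    (hs : ∃ i j, A i j = s) :
    3 * (Finset.univ.filter fun σ : Equiv.Perm (Fin 4) =>
      ∃ i j, i ≠ j ∧ A i (σ i) = s ∧ A j (σ j) = s).card + 7 ≤ 7 * mult A s := by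
  obtain ⟨τ, hτ⟩ := hA.exists_perm s
  let R : Finset (Fin 4) := Finset.univ.filter fun i => A i (τ i) = s
  have hmem : ∀ i j, A i j = s → i ∈ R ∧ τ i = j := by
    intro i j h
    have := hτ i j h
    subst this
    simpa [R] using h
  have hR : R.Nonempty := by
    obtain ⟨i, j, h⟩ := hs
    exact ⟨i, (hmem i j h).1⟩
  have hcard : R.card ≤ mult A s :=
    Finset.card_le_card_of_injOn (fun i => (i, τ i)) (fun i hi => by simpa [R] using hi)
      fun i _ j _ h => congrArg Prod.fst h
  have hle : (Finset.univ.filter fun σ : Equiv.Perm (Fin 4) =>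
      ∃ i j, i ≠ j ∧ A i (σ i) = s ∧ A j (σ j) = s).card ≤
      (Finset.univ.filter fun σ : Equiv.Perm (Fin 4) =>
        ∃ i ∈ R, ∃ j ∈ R, i ≠ j ∧ σ i = i ∧ σ j = j).card := by
    refine Finset.card_le_card_of_injOn (fun σ => τ⁻¹ * σ) (fun σ hσ => ?_)
      (mul_right_injective τ⁻¹).injOn
    obtain ⟨i, j, hij, hi, hj⟩ := (Finset.mem_filter.1 hσ).2
    obtain ⟨hiR, hi⟩ := hmem _ _ hi
    obtain ⟨hjR, hj⟩ := hmem _ _ hj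
    refine Finset.mem_coe.2 (Finset.mem_filter.2 ⟨Finset.mem_univ _, i, hiR, j, hjR, hij, ?_, ?_⟩)
    · simp [← hi]
    · simp [← hj]
  have := card_perm_fixing_two_le R hR
  lia

/-- A finite type covered by finitely many finsets has at most as many elements as these finsets
have in total. -/
lemma card_le_sum_card_of_cover {ι α : Type*} [Fintype α] (S : Finset ι) (K : ι → Finset α)
    (h : ∀ a, ∃ s ∈ S, a ∈ K s) : Fintype.card α ≤ ∑ s ∈ S, (K s).card := by
  classical
  rw [← Finset.card_univ]
  exact (Finset.card_le_card fun a _ => Finset.mem_biUnion.2 (h a)).trans Finset.card_biUnion_le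

theorem stmt_16 (A : Fin 4 → Fin 4 → ℕ) (hA : IsGLS A) (hsym : 6 ≤ numSymbols A) :
    HasTransversal A := by
  by_contra hno
  let S : Finset ℕ := Finset.image (fun p : Fin 4 × Fin 4 => A p.1 p.2) Finset.univ
  let K : ℕ → Finset (Equiv.Perm (Fin 4)) := fun s => Finset.univ.filter fun σ =>
    ∃ i j, i ≠ j ∧ A i (σ i) = s ∧ A j (σ j) = s
  have hcover : ∀ σ, ∃ s ∈ S, σ ∈ K s := by
    intro σ
    have hσ : ¬ Function.Injective fun i => A i (σ i) := fun h => hno ⟨σ, h⟩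
    obtain ⟨i, j, h, hij⟩ := Function.not_injective_iff.1 hσ
    exact ⟨A i (σ i), Finset.mem_image_of_mem _ (Finset.mem_univ (i, σ i)),
      Finset.mem_filter.2 ⟨Finset.mem_univ _, i, j, hij, rfl, h.symm⟩⟩
  have hperm : 24 ≤ ∑ s ∈ S, (K s).card := by
    have hcard : Fintype.card (Equiv.Perm (Fin 4)) = 24 := by
      rw [Fintype.card_perm, Fintype.card_fin]
      rfl
    exact hcard.symm.le.trans (card_le_sum_card_of_cover S K hcover)
  have hcells : ∑ s ∈ S, mult A s = 16 := by
    have := Finset.card_eq_sum_card_image (fun p : Fin 4 × Fin 4 => A p.1 p.2) Finset.univ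
    simpa [mult, S] using this.symm
  have hsum : ∑ s ∈ S, (3 * (K s).card + 7) ≤ ∑ s ∈ S, 7 * mult A s := by
    refine Finset.sum_le_sum fun s hs => hA.card_perm_repeating_le ?_
    obtain ⟨p, -, hp⟩ := Finset.mem_image.1 hs
    exact ⟨p.1, p.2, hp⟩
  rw [Finset.sum_add_distrib, ← Finset.mul_sum, ← Finset.mul_sum, Finset.sum_const, smul_eq_mul,
    hcells] at hsum
  change 6 ≤ S.card at hsym
  lia
end
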